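/- Fix d ≥ 1, T > 0, a compact interval Θ = [θ_min, θ_max] ⊂ (0,∞), a link function Φ, and a smooth ℤ^d-periodic initial value u_0. There exists a constant D > 0, depending only on d, T, Θ, Φ and u_0, such that: for all θ, θ₀ ∈ Θ and every continuous bounded ℤ^d-periodic F, if u_{θ,F}, u_{θ₀,F} are smooth classical solutions with absorption Φ∘F, initial value u_0 and diffusivities θ, θ₀, and w_{θ₀,F} is the associated θ-derivative solution at θ₀, then ‖u_{θ,F} − u_{θ₀,F} − (θ − θ₀) w_{θ₀,F}‖_{H^{2,1}(Q)} ≤ D |θ − θ₀|² (1 + ‖F‖_{L²(𝕋^d)})(1 + ‖F‖_∞)². (Lemma 'bounds', item (v): second-order Taylor bound in θ for the forward map.) -/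

import Mathlib

open MeasureTheory Real Filter

noncomputable section

/-- Partial derivative in the `i`-th spatial coordinate. -/
def pder {d : ℕ} (i : Fin d) (v : (Fin d → ℝ) → ℝ) : (Fin d → ℝ) → ℝ :=
  fun x => deriv (fun s => v (Function.update x i s)) (x i)

/-- Spatial Laplacian `Δ_x = ∑ᵢ ∂²/∂xᵢ²`. -/
def lap {d : ℕ} (v : (Fin d → ℝ) → ℝ) : (Fin d → ℝ) → ℝ :=
  fun x => ∑ i : Fin d, pder i (pder i v) x

/-- Multi-index spatial derivative `∂^j`. -/
def mder {d : ℕ} (j : Fin d → ℕ) (v : (Fin d → ℝ) → ℝ) : (Fin d → ℝ) → ℝ :=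
  (List.finRange d).foldr (fun i acc => (pder i)^[j i] acc) v

/-- `ℤ^d`-periodicity of a function on `ℝ^d`. -/
def ZPer {d : ℕ} (F : (Fin d → ℝ) → ℝ) : Prop :=
  ∀ (x : Fin d → ℝ) (k : Fin d → ℤ), F (fun i => x i + (k i : ℝ)) = F x

/-- `ℤ^d`-periodicity in the space variable. -/
def ZPerSpace {d : ℕ} (u : (Fin d → ℝ) → ℝ → ℝ) : Prop :=
  ∀ t : ℝ, ZPer fun x => u x t

/-- The fundamental domain `[0,1]^d` of the torus. -/
def unitCube (d : ℕ) : Set (Fin d → ℝ) := Set.Icc 0 1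

/-- `L²`-norm on the torus. -/
def l2T {d : ℕ} (F : (Fin d → ℝ) → ℝ) : ℝ :=
  Real.sqrt (∫ x in unitCube d, (F x) ^ 2)

/-- `L²`-norm on `Q = 𝕋^d × (0,T)`. -/
def l2Q {d : ℕ} (T : ℝ) (u : (Fin d → ℝ) → ℝ → ℝ) : ℝ :=
  Real.sqrt (∫ t in Set.Ioc (0 : ℝ) T, ∫ x in unitCube d, (u x t) ^ 2)

/-- Supremum norm over space. -/
def supT {d : ℕ} (F : (Fin d → ℝ) → ℝ) : ℝ := ⨆ x, |F x|

/-- Supremum norm over `𝕋^d × [0,T]`. -/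
def supQ {d : ℕ} (T : ℝ) (u : (Fin d → ℝ) → ℝ → ℝ) : ℝ :=
  ⨆ x, ⨆ t ∈ Set.Icc (0 : ℝ) T, |u x t|

/-- Squared Sobolev `H^β`-norm on the torus:  `∑_{|j| ≤ β} ‖∂^j F‖²_{L²(𝕋^d)}`. -/
def hSobSq {d : ℕ} (β : ℕ) (F : (Fin d → ℝ) → ℝ) : ℝ :=
  ∑ j ∈ Finset.univ.filter (fun j : Fin d → Fin (β + 1) => (∑ i, (j i : ℕ)) ≤ β),
    ∫ x in unitCube d, (mder (fun i => (j i : ℕ)) F x) ^ 2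

/-- Sobolev `H^β`-norm on the torus. -/
def hSob {d : ℕ} (β : ℕ) (F : (Fin d → ℝ) → ℝ) : ℝ := Real.sqrt (hSobSq β F)

/-- Squared parabolic Sobolev `H^{2,1}(Q)`-norm. -/
def h21Sq {d : ℕ} (T : ℝ) (u : (Fin d → ℝ) → ℝ → ℝ) : ℝ :=
  (∫ t in Set.Ioc (0 : ℝ) T,
      ∑ j ∈ Finset.univ.filter (fun j : Fin d → Fin 3 => (∑ i, (j i : ℕ)) ≤ 2),
        ∫ x in unitCube d, (mder (fun i => (j i : ℕ)) (fun y => u y t) x) ^ 2)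
    + ∫ x in unitCube d, ∫ t in Set.Ioc (0 : ℝ) T, ((u x t) ^ 2 + (deriv (u x) t) ^ 2)

/-- Parabolic Sobolev `H^{2,1}(Q)`-norm. -/
def h21 {d : ℕ} (T : ℝ) (u : (Fin d → ℝ) → ℝ → ℝ) : ℝ := Real.sqrt (h21Sq T u)

/-- Smoothness of a function of space and time. -/
def SmoothQ {d : ℕ} (u : (Fin d → ℝ) → ℝ → ℝ) : Prop :=
  ContDiff ℝ (⊤ : ℕ∞) fun p : (Fin d → ℝ) × ℝ => u p.1 p.2

/-- A smooth classical solution of the heat equation with absorption `f`,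
diffusivity `θ` and initial value `u0`. -/
def HeatSol {d : ℕ} (T θ : ℝ) (f u0 : (Fin d → ℝ) → ℝ) (u : (Fin d → ℝ) → ℝ → ℝ) : Prop :=
  SmoothQ u ∧ ZPerSpace u ∧
    (∀ (x : Fin d → ℝ), ∀ t ∈ Set.Ioc (0 : ℝ) T,
      deriv (u x) t = θ / 2 * lap (fun y => u y t) x - f x * u x t) ∧
    ∀ x, u x 0 = u0 x

/-- A smooth solution of the inhomogeneous problem with forcing `g` and
zero initial value (`v = 𝓛_{θ,f}⁻¹ g`). -/
def InhomSol {d : ℕ} (T θ : ℝ) (f : (Fin d → ℝ) → ℝ) (g v : (Fin d → ℝ) → ℝ → ℝ) : Prop :=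
  SmoothQ v ∧ ZPerSpace v ∧
    (∀ (x : Fin d → ℝ), ∀ t ∈ Set.Ioc (0 : ℝ) T,
      deriv (v x) t = θ / 2 * lap (fun y => v y t) x - f x * v x t + g x t) ∧
    ∀ x, v x 0 = 0

/-- A link function: a smooth function `Φ : ℝ → (fmin, ∞)` with strictly positive
derivative and all derivatives bounded. -/
structure LinkFun where
  toFun : ℝ → ℝ
  fmin : ℝ
  fmin_pos : 0 < fmin
  smooth : ContDiff ℝ (⊤ : ℕ∞) toFun
  gt_fmin : ∀ x, fmin < toFun x
  deriv_pos : ∀ x, 0 < deriv toFun x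
  derivs_bdd : ∀ n : ℕ, 1 ≤ n → ∃ C, ∀ x, |iteratedDeriv n toFun x| ≤ C

/-- The linearized solution `I_{θ,F} h` in direction `h`, associated with a solution `u`. -/
def LinSol {d : ℕ} (T θ : ℝ) (Φ : LinkFun) (F h : (Fin d → ℝ) → ℝ)
    (u z : (Fin d → ℝ) → ℝ → ℝ) : Prop :=
  SmoothQ z ∧ ZPerSpace z ∧
    (∀ (x : Fin d → ℝ), ∀ t ∈ Set.Ioc (0 : ℝ) T,
      deriv (z x) t = θ / 2 * lap (fun y => z y t) x - Φ.toFun (F x) * z x t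
        + h x * deriv Φ.toFun (F x) * u x t) ∧
    ∀ x, z x 0 = 0

/-- The `θ`-derivative solution `K̇_θ F`, associated with a solution `u`. -/
def ThetaDerivSol {d : ℕ} (T θ : ℝ) (Φ : LinkFun) (F : (Fin d → ℝ) → ℝ)
    (u w : (Fin d → ℝ) → ℝ → ℝ) : Prop :=
  SmoothQ w ∧ ZPerSpace w ∧
    (∀ (x : Fin d → ℝ), ∀ t ∈ Set.Ioc (0 : ℝ) T,
      deriv (w x) t = θ / 2 * lap (fun y => w y t) x - Φ.toFun (F x) * w x t
        + 1 / 2 * lap (fun y => u y t) x) ∧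
    ∀ x, w x 0 = 0

/-- Dual Sobolev norm `‖G‖_{(H²)*}` on the torus. -/
def h2dual {d : ℕ} (G : (Fin d → ℝ) → ℝ) : ℝ :=
  sSup {r : ℝ | ∃ g : (Fin d → ℝ) → ℝ, ContDiff ℝ (⊤ : ℕ∞) g ∧ ZPer g ∧ hSob 2 g ≤ 1 ∧
    r = |∫ x in unitCube d, G x * g x|}

end

section DirectionalCalculus

variable {d : ℕ}

/-- The derivative of `U` in the direction `e`, as a function of the base point. -/
noncomputable def dirDeriv (e : (Fin d → ℝ) × ℝ) (U : (Fin d → ℝ) × ℝ → ℝ) : (Fin d → ℝ) × ℝ → ℝ :=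
  fun p => fderiv ℝ U p e

/-- The unit vector of the `i`-th spatial coordinate in space-time. -/
def spaceDir (i : Fin d) : (Fin d → ℝ) × ℝ := (Pi.single i 1, 0)

/-- The unit vector of the time coordinate in space-time. -/
def timeDir : (Fin d → ℝ) × ℝ := (0, 1)

/-- `ℤ^d`-periodicity in space of a function on space-time. -/
def SpacePeriodic (U : (Fin d → ℝ) × ℝ → ℝ) : Prop :=
  ∀ (p : (Fin d → ℝ) × ℝ) (k : Fin d → ℤ), U (p + (fun i => (k i : ℝ), 0)) = U p

/-- The spatial Laplacian of a function on space-time. -/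
noncomputable def spaceLap (U : (Fin d → ℝ) × ℝ → ℝ) : (Fin d → ℝ) × ℝ → ℝ :=
  fun p => ∑ i : Fin d, dirDeriv (spaceDir i) (dirDeriv (spaceDir i) U) p

variable {U V : (Fin d → ℝ) × ℝ → ℝ}

theorem contDiff_dirDeriv (hU : ContDiff ℝ (⊤ : ℕ∞) U) (e : (Fin d → ℝ) × ℝ) :
    ContDiff ℝ (⊤ : ℕ∞) (dirDeriv e U) :=
  (hU.fderiv_right (m := (⊤ : ℕ∞)) le_rfl).clm_apply contDiff_const

theorem contDiff_spaceLap (hU : ContDiff ℝ (⊤ : ℕ∞) U) :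
    ContDiff ℝ (⊤ : ℕ∞) (spaceLap U) :=
  ContDiff.sum fun i _ => contDiff_dirDeriv (contDiff_dirDeriv hU (spaceDir i)) (spaceDir i)

theorem dirDeriv_comm (hU : ContDiff ℝ (⊤ : ℕ∞) U) (e e' : (Fin d → ℝ) × ℝ) :
    dirDeriv e (dirDeriv e' U) = dirDeriv e' (dirDeriv e U) := by
  have hd : Differentiable ℝ (fderiv ℝ U) :=
    (hU.fderiv_right (m := (⊤ : ℕ∞)) le_rfl).differentiable (by simp)
  have key : ∀ (a b p : (Fin d → ℝ) × ℝ),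
      dirDeriv a (dirDeriv b U) p = fderiv ℝ (fderiv ℝ U) p a b := by
    intro a b p
    unfold dirDeriv
    rw [fderiv_clm_apply (hd p) (by fun_prop)]
    simp
  funext p
  rw [key, key]
  refine (hU.contDiffAt.isSymmSndFDerivAt ?_) e e'
  rw [minSmoothness_of_isRCLikeNormedField]
  exact WithTop.coe_le_coe.2 (le_top : (2 : ℕ∞) ≤ ⊤)

theorem dirDeriv_mul (hU : ContDiff ℝ (⊤ : ℕ∞) U) (hV : ContDiff ℝ (⊤ : ℕ∞) V)
    (e p : (Fin d → ℝ) × ℝ) :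
    dirDeriv e (fun q => U q * V q) p = dirDeriv e U p * V p + U p * dirDeriv e V p := by
  unfold dirDeriv
  rw [fderiv_fun_mul (hU.differentiable (by simp) p) (hV.differentiable (by simp) p)]
  simp
  ring

theorem dirDeriv_sub (hU : ContDiff ℝ (⊤ : ℕ∞) U) (hV : ContDiff ℝ (⊤ : ℕ∞) V)
    (e : (Fin d → ℝ) × ℝ) :
    dirDeriv e (fun q => U q - V q) = fun p => dirDeriv e U p - dirDeriv e V p := by
  funext p
  unfold dirDeriv
  rw [fderiv_fun_sub (hU.differentiable (by simp) p) (hV.differentiable (by simp) p)]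
  simp

theorem dirDeriv_const_mul (hU : ContDiff ℝ (⊤ : ℕ∞) U) (c : ℝ) (e : (Fin d → ℝ) × ℝ) :
    dirDeriv e (fun q => c * U q) = fun p => c * dirDeriv e U p := by
  funext p
  unfold dirDeriv
  rw [fderiv_const_mul (hU.differentiable (by simp) p)]
  simp

theorem spaceLap_sub (hU : ContDiff ℝ (⊤ : ℕ∞) U) (hV : ContDiff ℝ (⊤ : ℕ∞) V)
    (p : (Fin d → ℝ) × ℝ) :
    spaceLap (fun q => U q - V q) p = spaceLap U p - spaceLap V p := by
  unfold spaceLap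
  rw [← Finset.sum_sub_distrib]
  refine Finset.sum_congr rfl fun i _ => ?_
  rw [dirDeriv_sub hU hV, dirDeriv_sub (contDiff_dirDeriv hU _) (contDiff_dirDeriv hV _)]

theorem spaceLap_const_mul (hU : ContDiff ℝ (⊤ : ℕ∞) U) (c : ℝ) (p : (Fin d → ℝ) × ℝ) :
    spaceLap (fun q => c * U q) p = c * spaceLap U p := by
  unfold spaceLap
  rw [Finset.mul_sum]
  refine Finset.sum_congr rfl fun i _ => ?_
  rw [dirDeriv_const_mul hU, dirDeriv_const_mul (contDiff_dirDeriv hU _)]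

theorem SpacePeriodic.dirDeriv (hU : SpacePeriodic U) (e : (Fin d → ℝ) × ℝ) :
    SpacePeriodic (dirDeriv e U) := by
  intro p k
  unfold _root_.dirDeriv
  rw [← fderiv_comp_add_right, show (fun q => U (q + _)) = U from funext fun q => hU q k]

theorem SpacePeriodic.mul (hU : SpacePeriodic U) (hV : SpacePeriodic V) :
    SpacePeriodic fun p => U p * V p := fun p k => by simp only [hU p k, hV p k]

theorem SpacePeriodic.sub (hU : SpacePeriodic U) (hV : SpacePeriodic V) :
    SpacePeriodic fun p => U p - V p := fun p k => by simp only [hU p k, hV p k]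

theorem SpacePeriodic.const_mul (hU : SpacePeriodic U) (c : ℝ) :
    SpacePeriodic fun p => c * U p := fun p k => by simp only [hU p k]

theorem hasDerivAt_time (hU : ContDiff ℝ (⊤ : ℕ∞) U) (x : Fin d → ℝ) (t : ℝ) :
    HasDerivAt (fun s => U (x, s)) (dirDeriv timeDir U (x, t)) t :=
  ((hU.differentiable (by simp) (x, t)).hasFDerivAt).comp_hasDerivAt t
    ((hasDerivAt_const t x).prodMk (hasDerivAt_id t))

theorem pder_slice (hU : ContDiff ℝ (⊤ : ℕ∞) U) (i : Fin d) (t : ℝ) :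
    pder i (fun y => U (y, t)) = fun x => dirDeriv (spaceDir i) U (x, t) := by
  funext x
  have h := (hasDerivAt_update x i (x i)).prodMk (hasDerivAt_const (x i) t)
  have hf := (hU.differentiable (by simp) (x, t)).hasFDerivAt
  have hx : (Function.update x i (x i), t) = (x, t) := by simp
  rw [← hx] at hf
  have := (hf.comp_hasDerivAt (x i) h).deriv
  simpa [pder, dirDeriv, spaceDir, Function.comp_def] using this

theorem lap_slice (hU : ContDiff ℝ (⊤ : ℕ∞) U) (x : Fin d → ℝ) (t : ℝ) :
    lap (fun y => U (y, t)) x = spaceLap U (x, t) := by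
  unfold lap spaceLap
  refine Finset.sum_congr rfl fun i _ => ?_
  rw [pder_slice hU, pder_slice (contDiff_dirDeriv hU _)]

theorem foldr_pder_iterate (j : Fin d → ℕ) (l : List (Fin d)) :
    ∃ m : List (Fin d), m.length = (l.map j).sum ∧ ∀ v : (Fin d → ℝ) → ℝ,
      l.foldr (fun i acc => (pder i)^[j i] acc) v = m.foldr pder v := by
  induction l with
  | nil => exact ⟨[], rfl, fun _ => rfl⟩
  | cons a l ih =>
    obtain ⟨m, hm, h⟩ := ih
    refine ⟨List.replicate (j a) a ++ m, by simp [hm], fun v => ?_⟩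
    rw [List.foldr_cons, h, List.foldr_append]
    generalize j a = n
    induction n with
    | zero => rfl
    | succ n ih => rw [Function.iterate_succ_apply', ih, List.replicate_succ, List.foldr_cons]

theorem exists_mder_eq_foldr (j : Fin d → ℕ) (hj : ∑ i, j i ≤ 2) :
    ∃ l : List (Fin d), l.length ≤ 2 ∧
      ∀ v : (Fin d → ℝ) → ℝ, mder j v = l.foldr pder v := by
  obtain ⟨l, hl, h⟩ := foldr_pder_iterate j (List.finRange d)
  rw [← Fin.sum_univ_def] at hl
  exact ⟨l, hl.trans_le hj, h⟩

end DirectionalCalculus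

section SpaceTimeIntegrals

variable {d : ℕ} {T : ℝ}

/-- Lebesgue measure on `[0,1]^d × (0,T]`. -/
noncomputable def cylMeasure (d : ℕ) (T : ℝ) : Measure ((Fin d → ℝ) × ℝ) :=
  (volume.restrict (unitCube d)).prod (volume.restrict (Set.Ioc 0 T))

theorem integrable_cyl {g : (Fin d → ℝ) × ℝ → ℝ} (hg : Continuous g) :
    Integrable g (cylMeasure d T) := by
  unfold cylMeasure
  rw [Measure.prod_restrict]
  have h : IntegrableOn g (unitCube d ×ˢ Set.Icc 0 T) (volume.prod volume) :=
    hg.continuousOn.integrableOn_compact (isCompact_Icc.prod isCompact_Icc)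
  exact h.mono_set (Set.prod_mono le_rfl Set.Ioc_subset_Icc_self)

theorem integrableOn_unitCube {g : (Fin d → ℝ) → ℝ} (hg : Continuous g) :
    IntegrableOn g (unitCube d) :=
  hg.continuousOn.integrableOn_compact isCompact_Icc

theorem ae_cyl_mem : ∀ᵐ p ∂(cylMeasure d T), p.2 ∈ Set.Ioc 0 T := by
  unfold cylMeasure
  rw [Measure.prod_restrict]
  filter_upwards [ae_restrict_mem (measurableSet_Icc.prod measurableSet_Ioc)] with p hp
  exact hp.2

theorem integral_cyl_mono {g h : (Fin d → ℝ) × ℝ → ℝ} (hg : Continuous g) (hh : Continuous h)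
    (hle : ∀ p : (Fin d → ℝ) × ℝ, p.2 ∈ Set.Ioc 0 T → g p ≤ h p) :
    ∫ p, g p ∂(cylMeasure d T) ≤ ∫ p, h p ∂(cylMeasure d T) := by
  refine integral_mono_ae (integrable_cyl hg) (integrable_cyl hh) ?_
  filter_upwards [ae_cyl_mem] with p hp using hle p hp

theorem integral_cyl_eq_time_space {g : (Fin d → ℝ) × ℝ → ℝ} (hg : Continuous g) :
    ∫ p, g p ∂(cylMeasure d T) = ∫ t in Set.Ioc 0 T, ∫ x in unitCube d, g (x, t) :=
  integral_prod_symm _ (integrable_cyl hg)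

theorem integral_cyl_eq_space_time {g : (Fin d → ℝ) × ℝ → ℝ} (hg : Continuous g) :
    ∫ p, g p ∂(cylMeasure d T) = ∫ x in unitCube d, ∫ t in Set.Ioc 0 T, g (x, t) :=
  integral_prod _ (integrable_cyl hg)

theorem integral_unitCube_dirDeriv_eq_zero {U : (Fin d → ℝ) × ℝ → ℝ}
    (hU : ContDiff ℝ (⊤ : ℕ∞) U) (hper : SpacePeriodic U) (i : Fin d) (t : ℝ) :
    ∫ x in unitCube d, dirDeriv (spaceDir i) U (x, t) = 0 := by
  obtain ⟨n, rfl⟩ : ∃ n, d = n + 1 := ⟨d - 1, by have := i.2; omega⟩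
  set L : (Fin (n + 1) → ℝ) →L[ℝ] (Fin (n + 1) → ℝ) × ℝ := ContinuousLinearMap.inl ℝ _ _
  have hder : ∀ x, HasFDerivAt (fun y => U (y, t)) ((fderiv ℝ U (x, t)).comp L) x := fun x =>
    (hU.differentiable (by simp) (x, t)).hasFDerivAt.comp x (hasFDerivAt_prodMk_left x t)
  have hcont : Continuous fun x => dirDeriv (spaceDir i) U (x, t) :=
    (contDiff_dirDeriv hU _).continuous.comp (by fun_prop)
  have hsum : ∀ x, ∑ k : Fin (n + 1),
      (if k = i then (fderiv ℝ U (x, t)).comp L else 0) (Pi.single k 1)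
        = dirDeriv (spaceDir i) U (x, t) := by
    intro x
    rw [Finset.sum_eq_single i (fun k _ hk => by simp [hk]) (by simp)]
    simp [L, dirDeriv, spaceDir]
  have h := integral_divergence_of_hasFDerivAt_off_countable' (0 : Fin (n + 1) → ℝ) 1
    zero_le_one (fun k x => if k = i then U (x, t) else 0)
    (fun k x => if k = i then (fderiv ℝ U (x, t)).comp L else 0) ∅ Set.countable_empty
    (fun k => by
      by_cases hk : k = i
      · simp only [hk, if_true]
        exact (hU.continuous.comp (by fun_prop)).continuousOn
      · simp only [hk, if_false]
        exact continuousOn_const)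
    (fun x _ k => by
      by_cases hk : k = i
      · simp only [hk, if_true]
        exact hder x
      · simp only [hk, if_false]
        exact hasFDerivAt_const _ _)
    (by
      simp only [hsum]
      exact integrableOn_unitCube hcont)
  simp only [hsum] at h
  unfold unitCube
  rw [h]
  refine Finset.sum_eq_zero fun k _ => ?_
  by_cases hk : k = i
  · subst hk
    rw [sub_eq_zero]
    refine integral_congr_ae (ae_of_all _ fun y => ?_)
    have := hper (k.insertNth 0 y, t) (Pi.single k 1)
    simp only [if_true]
    rw [Pi.one_apply, Pi.zero_apply, ← this]
    congr 1
    ext l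
    · refine Fin.succAboveCases k ?_ (fun m => ?_) l <;> simp
    · simp
  · simp [hk]

theorem integral_cyl_dirDeriv_space {U : (Fin d → ℝ) × ℝ → ℝ}
    (hU : ContDiff ℝ (⊤ : ℕ∞) U) (hper : SpacePeriodic U) (i : Fin d) :
    ∫ p, dirDeriv (spaceDir i) U p ∂(cylMeasure d T) = 0 := by
  rw [integral_cyl_eq_time_space (contDiff_dirDeriv hU _).continuous]
  simp [integral_unitCube_dirDeriv_eq_zero hU hper]

theorem integral_cyl_mul_dirDeriv_time (hT : 0 ≤ T) {f : (Fin d → ℝ) → ℝ} (hf : Continuous f)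
    {U : (Fin d → ℝ) × ℝ → ℝ} (hU : ContDiff ℝ (⊤ : ℕ∞) U) :
    ∫ p, f p.1 * dirDeriv timeDir U p ∂(cylMeasure d T)
      = ∫ x in unitCube d, f x * (U (x, T) - U (x, 0)) := by
  have hc := (contDiff_dirDeriv hU timeDir).continuous
  rw [integral_cyl_eq_space_time (by fun_prop)]
  refine integral_congr_ae (ae_of_all _ fun x => ?_)
  simp only
  rw [integral_const_mul, ← intervalIntegral.integral_of_le hT,
    intervalIntegral.integral_eq_sub_of_hasDerivAt (fun t _ => hasDerivAt_time hU x t)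
      (Continuous.intervalIntegrable (by fun_prop) _ _)]

end SpaceTimeIntegrals

section EnergyEstimates

variable {d : ℕ} {T : ℝ}

theorem integral_cyl_sum_dirDeriv_space {W : Fin d → (Fin d → ℝ) × ℝ → ℝ}
    (hW : ∀ i, ContDiff ℝ (⊤ : ℕ∞) (W i)) (hper : ∀ i, SpacePeriodic (W i)) :
    ∫ p, ∑ i, dirDeriv (spaceDir i) (W i) p ∂(cylMeasure d T) = 0 := by
  rw [integral_finsetSum _ fun i _ => integrable_cyl (contDiff_dirDeriv (hW i) _).continuous]
  exact Finset.sum_eq_zero fun i _ => integral_cyl_dirDeriv_space (hW i) (hper i) i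

theorem integral_cyl_dirDeriv_dirDeriv_sq {Z : (Fin d → ℝ) × ℝ → ℝ}
    (hZ : ContDiff ℝ (⊤ : ℕ∞) Z) (hper : SpacePeriodic Z) (i k : Fin d) :
    ∫ p, (dirDeriv (spaceDir i) (dirDeriv (spaceDir k) Z) p) ^ 2 ∂(cylMeasure d T)
      = ∫ p, dirDeriv (spaceDir i) (dirDeriv (spaceDir i) Z) p
          * dirDeriv (spaceDir k) (dirDeriv (spaceDir k) Z) p ∂(cylMeasure d T) := by
  have hi := contDiff_dirDeriv hZ (spaceDir i)
  have hk := contDiff_dirDeriv hZ (spaceDir k)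
  have hik := contDiff_dirDeriv hk (spaceDir i)
  have hii := contDiff_dirDeriv hi (spaceDir i)
  have hkk := contDiff_dirDeriv hk (spaceDir k)
  have hiip := (hper.dirDeriv (spaceDir i)).dirDeriv (spaceDir i)
  have hikp := (hper.dirDeriv (spaceDir k)).dirDeriv (spaceDir i)
  have hkp := hper.dirDeriv (spaceDir k)
  have h1 := integral_cyl_dirDeriv_space (T := T) (hk.mul hik) (hkp.mul hikp) i
  have h2 := integral_cyl_dirDeriv_space (T := T) (hk.mul hii) (hkp.mul hiip) k
  have c1 := (contDiff_dirDeriv (hk.mul hik) (spaceDir i)).continuous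
  have c2 := (contDiff_dirDeriv (hk.mul hii) (spaceDir k)).continuous
  have cii := hii.continuous
  have ckk := hkk.continuous
  have hcomm : dirDeriv (spaceDir k) (dirDeriv (spaceDir i) (dirDeriv (spaceDir i) Z))
      = dirDeriv (spaceDir i) (dirDeriv (spaceDir i) (dirDeriv (spaceDir k) Z)) := by
    rw [dirDeriv_comm hi, dirDeriv_comm hZ]
  have hpt : ∀ p, (dirDeriv (spaceDir i) (dirDeriv (spaceDir k) Z) p) ^ 2
      = dirDeriv (spaceDir i) (dirDeriv (spaceDir i) Z) p
          * dirDeriv (spaceDir k) (dirDeriv (spaceDir k) Z) p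
        + dirDeriv (spaceDir i) (fun q => dirDeriv (spaceDir k) Z q
            * dirDeriv (spaceDir i) (dirDeriv (spaceDir k) Z) q) p
        - dirDeriv (spaceDir k) (fun q => dirDeriv (spaceDir k) Z q
            * dirDeriv (spaceDir i) (dirDeriv (spaceDir i) Z) q) p := by
    intro p
    rw [dirDeriv_mul hk hik, dirDeriv_mul hk hii, hcomm]
    ring
  simp only [hpt]
  rw [integral_sub (integrable_cyl (by fun_prop)) (integrable_cyl (by fun_prop)),
    integral_add (integrable_cyl (by fun_prop)) (integrable_cyl (by fun_prop)), h1, h2]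
  ring

theorem sum_integral_cyl_dirDeriv_dirDeriv_sq {Z : (Fin d → ℝ) × ℝ → ℝ}
    (hZ : ContDiff ℝ (⊤ : ℕ∞) Z) (hper : SpacePeriodic Z) :
    ∑ i : Fin d, ∑ k : Fin d,
        ∫ p, (dirDeriv (spaceDir i) (dirDeriv (spaceDir k) Z) p) ^ 2 ∂(cylMeasure d T)
      = ∫ p, (spaceLap Z p) ^ 2 ∂(cylMeasure d T) := by
  have hc : ∀ i : Fin d, Continuous (dirDeriv (spaceDir i) (dirDeriv (spaceDir i) Z)) := fun i =>
    (contDiff_dirDeriv (contDiff_dirDeriv hZ _) _).continuous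
  simp only [integral_cyl_dirDeriv_dirDeriv_sq hZ hper]
  simp only [spaceLap, sq, Finset.sum_mul_sum]
  rw [integral_finsetSum _ fun i _ => integrable_cyl (by fun_prop)]
  refine Finset.sum_congr rfl fun i _ => ?_
  rw [integral_finsetSum _ fun k _ => integrable_cyl (by fun_prop)]

theorem sum_integral_cyl_dirDeriv_sq_le {Z : (Fin d → ℝ) × ℝ → ℝ}
    (hZ : ContDiff ℝ (⊤ : ℕ∞) Z) (hper : SpacePeriodic Z) :
    ∑ i : Fin d, ∫ p, (dirDeriv (spaceDir i) Z p) ^ 2 ∂(cylMeasure d T)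
      ≤ (∫ p, (Z p) ^ 2 ∂(cylMeasure d T)) + ∫ p, (spaceLap Z p) ^ 2 ∂(cylMeasure d T) := by
  have hi := fun i : Fin d => contDiff_dirDeriv hZ (spaceDir i)
  have hci := fun i : Fin d => (hi i).continuous
  have hcL := (contDiff_spaceLap hZ).continuous
  have hcZ := hZ.continuous
  have hm := fun i : Fin d => hZ.mul (hi i)
  have hcm := fun i : Fin d => (contDiff_dirDeriv (hm i) (spaceDir i)).continuous
  have h0 := integral_cyl_sum_dirDeriv_space (T := T) hm
    fun i => hper.mul (hper.dirDeriv (spaceDir i))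
  rw [← integral_finsetSum _ fun i _ => integrable_cyl (by fun_prop),
    ← integral_add (integrable_cyl (by fun_prop)) (integrable_cyl (by fun_prop))]
  refine (integral_cyl_mono (h := fun p => (Z p ^ 2 + spaceLap Z p ^ 2)
    + ∑ i, dirDeriv (spaceDir i) (fun q => Z q * dirDeriv (spaceDir i) Z q) p)
    (by fun_prop) (by fun_prop) fun p _ => ?_).trans_eq
    (by rw [integral_add (integrable_cyl (by fun_prop)) (integrable_cyl (by fun_prop)), h0,
      add_zero])
  have : ∑ i, dirDeriv (spaceDir i) (fun q => Z q * dirDeriv (spaceDir i) Z q) p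
      = (∑ i, (dirDeriv (spaceDir i) Z p) ^ 2) + Z p * spaceLap Z p := by
    rw [spaceLap, Finset.mul_sum, ← Finset.sum_add_distrib]
    refine Finset.sum_congr rfl fun i _ => ?_
    rw [dirDeriv_mul hZ (hi i)]
    ring
  rw [this]
  nlinarith [sq_nonneg (Z p + spaceLap Z p), sq_nonneg (Z p), sq_nonneg (spaceLap Z p)]

theorem integral_cyl_absorption_mul_sq_le (hT : 0 ≤ T) {κ m : ℝ} (hκ : 0 ≤ κ) (hm : 0 < m)
    {f : (Fin d → ℝ) → ℝ} (hf : Continuous f) (hmf : ∀ x, m ≤ f x)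
    {Z g : (Fin d → ℝ) × ℝ → ℝ} (hZ : ContDiff ℝ (⊤ : ℕ∞) Z) (hper : SpacePeriodic Z)
    (hg : Continuous g)
    (heq : ∀ p : (Fin d → ℝ) × ℝ, p.2 ∈ Set.Ioc 0 T →
      dirDeriv timeDir Z p = κ * spaceLap Z p - f p.1 * Z p + g p) :
    ∫ p, f p.1 * (Z p) ^ 2 ∂(cylMeasure d T)
      ≤ (∫ x in unitCube d, (Z (x, 0)) ^ 2) + m⁻¹ * ∫ p, (g p) ^ 2 ∂(cylMeasure d T) := by
  have hi := fun i : Fin d => contDiff_dirDeriv hZ (spaceDir i)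
  have hcZ := hZ.continuous
  have hmul := fun i : Fin d => hZ.mul (hi i)
  have hcm := continuous_finsetSum Finset.univ fun (i : Fin d) _ =>
    (contDiff_dirDeriv (hmul i) (spaceDir i)).continuous
  have h0 := integral_cyl_sum_dirDeriv_space (T := T) hmul
    fun i => hper.mul (hper.dirDeriv (spaceDir i))
  have ht := integral_cyl_mul_dirDeriv_time hT continuous_const (f := fun _ => -1) (hZ.mul hZ)
  have hct := (contDiff_dirDeriv (hZ.mul hZ) timeDir).continuous
  have hle := integral_cyl_mono (T := T) (g := fun p => f p.1 * (Z p) ^ 2)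
    (h := fun p => -1 * dirDeriv timeDir (fun q => Z q * Z q) p
      + 2 * κ * (∑ i, dirDeriv (spaceDir i) (fun q => Z q * dirDeriv (spaceDir i) Z q) p)
      + m⁻¹ * (g p) ^ 2) (by fun_prop) (by fun_prop) (by
    intro p hp
    have hs : ∑ i, dirDeriv (spaceDir i) (fun q => Z q * dirDeriv (spaceDir i) Z q) p
        = (∑ i, (dirDeriv (spaceDir i) Z p) ^ 2) + Z p * spaceLap Z p := by
      rw [spaceLap, Finset.mul_sum, ← Finset.sum_add_distrib]
      refine Finset.sum_congr rfl fun i _ => ?_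
      rw [dirDeriv_mul hZ (hi i)]
      ring
    have hG : 0 ≤ κ * ∑ i, (dirDeriv (spaceDir i) Z p) ^ 2 :=
      mul_nonneg hκ (Finset.sum_nonneg fun i _ => sq_nonneg _)
    have hyoung : 2 * (g p * Z p) ≤ m * (Z p) ^ 2 + m⁻¹ * (g p) ^ 2 := by
      have h1 : 0 ≤ m⁻¹ * (m * Z p - g p) ^ 2 := by positivity
      have h2 : m⁻¹ * (m * Z p - g p) ^ 2
          = m * (Z p) ^ 2 + m⁻¹ * (g p) ^ 2 - 2 * (g p * Z p) := by
        field_simp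
        ring
      linarith
    have hfm : m * (Z p) ^ 2 ≤ f p.1 * (Z p) ^ 2 :=
      mul_le_mul_of_nonneg_right (hmf _) (sq_nonneg _)
    rw [hs, dirDeriv_mul hZ hZ, heq p hp]
    linarith)
  rw [integral_add (integrable_cyl (by fun_prop)) (integrable_cyl (by fun_prop)),
    integral_add (integrable_cyl (by fun_prop)) (integrable_cyl (by fun_prop)),
    integral_const_mul (2 * κ), integral_const_mul m⁻¹, h0, ht] at hle
  have hb : ∫ x in unitCube d, -1 * (Z (x, T) * Z (x, T) - Z (x, 0) * Z (x, 0))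
      ≤ ∫ x in unitCube d, (Z (x, 0)) ^ 2 :=
    integral_mono (integrableOn_unitCube (by fun_prop)) (integrableOn_unitCube (by fun_prop))
      fun x => by simp only; nlinarith [sq_nonneg (Z (x, T))]
  linarith

theorem integral_cyl_dirDeriv_time_sq_le (hT : 0 ≤ T) {κ : ℝ} (hκ : 0 ≤ κ)
    {f : (Fin d → ℝ) → ℝ} (hf : Continuous f) (hf0 : ∀ x, 0 ≤ f x)
    {Z g : (Fin d → ℝ) × ℝ → ℝ} (hZ : ContDiff ℝ (⊤ : ℕ∞) Z) (hper : SpacePeriodic Z)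
    (hg : Continuous g)
    (heq : ∀ p : (Fin d → ℝ) × ℝ, p.2 ∈ Set.Ioc 0 T →
      dirDeriv timeDir Z p = κ * spaceLap Z p - f p.1 * Z p + g p) :
    ∫ p, (dirDeriv timeDir Z p) ^ 2 ∂(cylMeasure d T)
      ≤ κ * (∑ i : Fin d, ∫ x in unitCube d, (dirDeriv (spaceDir i) Z (x, 0)) ^ 2)
        + (∫ x in unitCube d, f x * (Z (x, 0)) ^ 2) + ∫ p, (g p) ^ 2 ∂(cylMeasure d T) := by
  have hi := fun i : Fin d => contDiff_dirDeriv hZ (spaceDir i)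
  have hci := fun i : Fin d => (hi i).continuous
  have ht := contDiff_dirDeriv hZ timeDir
  have hcZ := hZ.continuous
  have hct := ht.continuous
  have hmul := fun i : Fin d => ht.mul (hi i)
  have hcm := continuous_finsetSum Finset.univ fun (i : Fin d) _ =>
    (contDiff_dirDeriv (hmul i) (spaceDir i)).continuous
  have h0 := integral_cyl_sum_dirDeriv_space (T := T) hmul
    fun i => (hper.dirDeriv timeDir).mul (hper.dirDeriv (spaceDir i))
  have hZt := integral_cyl_mul_dirDeriv_time hT hf.neg (f := fun x => -f x) (hZ.mul hZ)
  have hcZt := (contDiff_dirDeriv (hZ.mul hZ) timeDir).continuous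
  have hGt := fun i : Fin d =>
    integral_cyl_mul_dirDeriv_time hT continuous_const (f := fun _ => -κ) ((hi i).mul (hi i))
  have hcGt := fun i : Fin d => (contDiff_dirDeriv ((hi i).mul (hi i)) timeDir).continuous
  have hle := integral_cyl_mono (T := T) (g := fun p => (dirDeriv timeDir Z p) ^ 2)
    (h := fun p => (∑ i, -κ * dirDeriv timeDir
        (fun q => dirDeriv (spaceDir i) Z q * dirDeriv (spaceDir i) Z q) p)
      + -f p.1 * dirDeriv timeDir (fun q => Z q * Z q) p
      + 2 * κ * (∑ i, dirDeriv (spaceDir i)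
          (fun q => dirDeriv timeDir Z q * dirDeriv (spaceDir i) Z q) p)
      + (g p) ^ 2) (by fun_prop) (by fun_prop) (by
    intro p hp
    have hs : ∑ i, dirDeriv (spaceDir i)
          (fun q => dirDeriv timeDir Z q * dirDeriv (spaceDir i) Z q) p
        = (∑ i, dirDeriv timeDir (dirDeriv (spaceDir i) Z) p * dirDeriv (spaceDir i) Z p)
          + dirDeriv timeDir Z p * spaceLap Z p := by
      rw [spaceLap, Finset.mul_sum, ← Finset.sum_add_distrib]
      refine Finset.sum_congr rfl fun i _ => ?_
      rw [dirDeriv_mul ht (hi i), dirDeriv_comm hZ]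
    have hs' : ∑ i, -κ * dirDeriv timeDir
          (fun q => dirDeriv (spaceDir i) Z q * dirDeriv (spaceDir i) Z q) p
        = -(2 * κ) *
          ∑ i, dirDeriv timeDir (dirDeriv (spaceDir i) Z) p * dirDeriv (spaceDir i) Z p := by
      rw [Finset.mul_sum]
      refine Finset.sum_congr rfl fun i _ => ?_
      rw [dirDeriv_mul (hi i) (hi i)]
      ring
    rw [hs, hs', dirDeriv_mul hZ hZ]
    have h1 : κ * spaceLap Z p = dirDeriv timeDir Z p + f p.1 * Z p - g p := by
      rw [heq p hp]; ring
    have h2 : 2 * κ * (dirDeriv timeDir Z p * spaceLap Z p)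
        = 2 * dirDeriv timeDir Z p * (dirDeriv timeDir Z p + f p.1 * Z p - g p) := by
      rw [← h1]; ring
    nlinarith [sq_nonneg (dirDeriv timeDir Z p - g p)])
  rw [integral_add (integrable_cyl (by fun_prop)) (integrable_cyl (by fun_prop)),
    integral_add (integrable_cyl (by fun_prop)) (integrable_cyl (by fun_prop)),
    integral_add (integrable_cyl (by fun_prop)) (integrable_cyl (by fun_prop)),
    integral_const_mul (2 * κ), h0, hZt,
    integral_finsetSum _ fun i _ => integrable_cyl (by fun_prop)] at hle
  simp only [hGt] at hle
  have hbZ : ∫ x in unitCube d, -f x * (Z (x, T) * Z (x, T) - Z (x, 0) * Z (x, 0))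
      ≤ ∫ x in unitCube d, f x * (Z (x, 0)) ^ 2 :=
    integral_mono (integrableOn_unitCube (by fun_prop)) (integrableOn_unitCube (by fun_prop))
      fun x => by simp only; nlinarith [mul_nonneg (hf0 x) (sq_nonneg (Z (x, T)))]
  have hbG : ∑ i : Fin d, ∫ x in unitCube d,
        -κ * (dirDeriv (spaceDir i) Z (x, T) * dirDeriv (spaceDir i) Z (x, T)
          - dirDeriv (spaceDir i) Z (x, 0) * dirDeriv (spaceDir i) Z (x, 0))
      ≤ κ * ∑ i : Fin d, ∫ x in unitCube d, (dirDeriv (spaceDir i) Z (x, 0)) ^ 2 := by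
    rw [Finset.mul_sum]
    refine Finset.sum_le_sum fun i _ => ?_
    rw [← integral_const_mul κ]
    exact integral_mono (integrableOn_unitCube (by fun_prop)) (integrableOn_unitCube (by fun_prop))
      fun x => by
        simp only
        nlinarith [mul_nonneg hκ (sq_nonneg (dirDeriv (spaceDir i) Z (x, T)))]
  linarith

/-- The squared `H¹`-norm on `[0,1]^d`. -/
noncomputable def h1Sq (v : (Fin d → ℝ) → ℝ) : ℝ :=
  (∫ x in unitCube d, (v x) ^ 2) + ∑ i : Fin d, ∫ x in unitCube d, (pder i v x) ^ 2

/-- Constant in the maximal regularity estimate for diffusivities in `[a, b]` and absorptions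
bounded below by `m`. -/
noncomputable def regularityConst (a b m : ℝ) : ℝ :=
  (1 + 3 * (a ^ 2)⁻¹) * (b + 3 + m⁻¹ + (m⁻¹) ^ 2)

theorem heat_maximal_regularity (hT : 0 ≤ T) {a b κ m A : ℝ} (ha : 0 < a) (hκ : κ ∈ Set.Icc a b)
    (hm : 0 < m) {f : (Fin d → ℝ) → ℝ} (hf : Continuous f) (hmf : ∀ x, m ≤ f x)
    (hfA : ∀ x, f x ≤ A)
    {Z g : (Fin d → ℝ) × ℝ → ℝ} (hZ : ContDiff ℝ (⊤ : ℕ∞) Z) (hper : SpacePeriodic Z)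
    (hg : Continuous g)
    (heq : ∀ p : (Fin d → ℝ) × ℝ, p.2 ∈ Set.Ioc 0 T →
      dirDeriv timeDir Z p = κ * spaceLap Z p - f p.1 * Z p + g p) {B : ℝ}
    (hB : B = regularityConst a b m * (1 + A) *
      (h1Sq (fun x => Z (x, 0)) + ∫ p, (g p) ^ 2 ∂(cylMeasure d T))) :
    ∫ p, (Z p) ^ 2 ∂(cylMeasure d T) ≤ B ∧
    ∫ p, (dirDeriv timeDir Z p) ^ 2 ∂(cylMeasure d T) ≤ B ∧
    ∫ p, (spaceLap Z p) ^ 2 ∂(cylMeasure d T) ≤ B := by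
  have hκ0 : 0 < κ := ha.trans_le hκ.1
  have hb : 0 < b := hκ0.trans_le hκ.2
  have hA : 0 < A := hm.trans_le ((hmf 0).trans (hfA 0))
  have hcZ := hZ.continuous
  have hct := (contDiff_dirDeriv hZ timeDir).continuous
  have hcL := (contDiff_spaceLap hZ).continuous
  have habs := integral_cyl_absorption_mul_sq_le hT hκ0.le hm hf hmf hZ hper hg heq
  have htime := integral_cyl_dirDeriv_time_sq_le hT hκ0.le hf (fun x => hm.le.trans (hmf x))
    hZ hper hg heq
  have hmass : ∫ p, (Z p) ^ 2 ∂(cylMeasure d T)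
      ≤ m⁻¹ * ∫ p, f p.1 * (Z p) ^ 2 ∂(cylMeasure d T) := by
    rw [← integral_const_mul]
    refine integral_cyl_mono (by fun_prop) (by fun_prop) fun p _ => ?_
    have h := mul_le_mul_of_nonneg_right (hmf p.1) (sq_nonneg (Z p))
    calc (Z p) ^ 2 = m⁻¹ * (m * (Z p) ^ 2) := by field_simp
      _ ≤ _ := mul_le_mul_of_nonneg_left h (by positivity)
  have hinit : ∫ x in unitCube d, f x * (Z (x, 0)) ^ 2
      ≤ A * ∫ x in unitCube d, (Z (x, 0)) ^ 2 := by
    rw [← integral_const_mul]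
    exact integral_mono (integrableOn_unitCube (by fun_prop)) (integrableOn_unitCube (by fun_prop))
      fun x => mul_le_mul_of_nonneg_right (hfA x) (sq_nonneg _)
  have hlap : κ ^ 2 * ∫ p, (spaceLap Z p) ^ 2 ∂(cylMeasure d T)
      ≤ 3 * ((∫ p, (dirDeriv timeDir Z p) ^ 2 ∂(cylMeasure d T))
        + A * (∫ p, f p.1 * (Z p) ^ 2 ∂(cylMeasure d T))
        + ∫ p, (g p) ^ 2 ∂(cylMeasure d T)) := by
    rw [← integral_const_mul, ← integral_const_mul A,
      ← integral_add (integrable_cyl (by fun_prop)) (integrable_cyl (by fun_prop)),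
      ← integral_add (integrable_cyl (by fun_prop)) (integrable_cyl (by fun_prop)),
      ← integral_const_mul]
    refine integral_cyl_mono (by fun_prop) (by fun_prop) fun p hp => ?_
    have h1 : κ * spaceLap Z p = dirDeriv timeDir Z p + f p.1 * Z p - g p := by
      rw [heq p hp]; ring
    have h2 : (f p.1 * Z p) ^ 2 ≤ A * (f p.1 * (Z p) ^ 2) := by
      have h := mul_le_mul_of_nonneg_right (hfA p.1)
        (mul_nonneg (hm.le.trans (hmf p.1)) (sq_nonneg (Z p)))
      linarith
    rw [← mul_pow, h1]
    nlinarith [sq_nonneg (dirDeriv timeDir Z p - f p.1 * Z p),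
      sq_nonneg (dirDeriv timeDir Z p + g p), sq_nonneg (f p.1 * Z p + g p)]
  simp only [h1Sq, pder_slice hZ] at hB
  have hN : 0 ≤ ∫ x in unitCube d, (Z (x, 0)) ^ 2 := integral_nonneg fun x => sq_nonneg _
  have hG : 0 ≤ ∑ i : Fin d, ∫ x in unitCube d, (dirDeriv (spaceDir i) Z (x, 0)) ^ 2 :=
    Finset.sum_nonneg fun i _ => integral_nonneg fun x => sq_nonneg _
  have hS : 0 ≤ ∫ p, (g p) ^ 2 ∂(cylMeasure d T) := integral_nonneg fun p => sq_nonneg _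
  generalize (∫ x in unitCube d, (Z (x, 0)) ^ 2) = N at *
  generalize (∑ i : Fin d, ∫ x in unitCube d, (dirDeriv (spaceDir i) Z (x, 0)) ^ 2) = G at *
  generalize (∫ p, (g p) ^ 2 ∂(cylMeasure d T)) = S at *
  generalize (∫ p, f p.1 * (Z p) ^ 2 ∂(cylMeasure d T)) = Y at *
  generalize (∫ p, (dirDeriv timeDir Z p) ^ 2 ∂(cylMeasure d T)) = τ at *
  set X := N + G + S with hX
  have hX0 : 0 ≤ X := by positivity
  have hm' : 0 < m⁻¹ := inv_pos.2 hm
  have hY : Y ≤ (1 + m⁻¹) * X := by nlinarith [mul_nonneg hm'.le hN, mul_nonneg hm'.le hG]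
  have hτ : τ ≤ (b + 1) * (1 + A) * X := by
    have h1 : κ * G ≤ b * G := mul_le_mul_of_nonneg_right hκ.2 hG
    have h2 : τ ≤ b * X + A * X + X := by
      nlinarith [mul_nonneg hb.le hN, mul_nonneg hb.le hS, mul_nonneg hA.le hG,
        mul_nonneg hA.le hS]
    nlinarith [mul_nonneg (mul_nonneg hb.le hA.le) hX0]
  have hc : 0 ≤ 3 * (a ^ 2)⁻¹ := by positivity
  have hfac : 0 ≤ (b + 3 + m⁻¹ + (m⁻¹) ^ 2) * (1 + A) * X := by positivity
  have hB' : (b + 3 + m⁻¹ + (m⁻¹) ^ 2) * (1 + A) * X ≤ B := by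
    rw [hB, regularityConst]
    nlinarith [mul_nonneg hc hfac]
  have hAX := mul_nonneg hA.le hX0
  refine ⟨hmass.trans (le_trans ?_ hB'), hτ.trans (le_trans ?_ hB'), ?_⟩
  · calc m⁻¹ * Y ≤ m⁻¹ * ((1 + m⁻¹) * X) := mul_le_mul_of_nonneg_left hY hm'.le
      _ = (m⁻¹ + (m⁻¹) ^ 2) * 1 * X := by ring
      _ ≤ _ := mul_le_mul_of_nonneg_right
          (mul_le_mul (by linarith) (by linarith) zero_le_one (by positivity)) hX0
  · have := sq_nonneg m⁻¹
    exact mul_le_mul_of_nonneg_right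
      (mul_le_mul_of_nonneg_right (by linarith) (by linarith)) hX0
  · have h1 : κ ^ 2 * ∫ p, (spaceLap Z p) ^ 2 ∂(cylMeasure d T)
        ≤ 3 * ((b + 3 + m⁻¹ + (m⁻¹) ^ 2) * (1 + A) * X) := by
      have h2 : A * Y ≤ A * ((1 + m⁻¹) * X) := mul_le_mul_of_nonneg_left hY hA.le
      have h3 : S ≤ X := by linarith
      linarith [mul_nonneg hm'.le hX0, mul_nonneg hm'.le hAX, mul_nonneg (sq_nonneg m⁻¹) hX0,
        mul_nonneg (sq_nonneg m⁻¹) hAX]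
    have h0 : 0 ≤ ∫ p, (spaceLap Z p) ^ 2 ∂(cylMeasure d T) := integral_nonneg fun p => sq_nonneg _
    have h4 : a ^ 2 * ∫ p, (spaceLap Z p) ^ 2 ∂(cylMeasure d T)
        ≤ 3 * ((b + 3 + m⁻¹ + (m⁻¹) ^ 2) * (1 + A) * X) :=
      le_trans (mul_le_mul_of_nonneg_right (pow_le_pow_left₀ ha.le hκ.1 2) h0) h1
    rw [mul_comm, ← le_div_iff₀ (by positivity)] at h4
    refine h4.trans ?_
    rw [hB, regularityConst, div_eq_mul_inv]
    linarith

/-- Number of multi-indices of order at most two. -/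
def numMultiIndices (d : ℕ) : ℕ :=
  (Finset.univ.filter (fun j : Fin d → Fin 3 => (∑ i, (j i : ℕ)) ≤ 2)).card

theorem mder_slice_of_sum_le_two {Z : (Fin d → ℝ) × ℝ → ℝ} (hZ : ContDiff ℝ (⊤ : ℕ∞) Z)
    (hper : SpacePeriodic Z) {B : ℝ} (hmass : ∫ p, (Z p) ^ 2 ∂(cylMeasure d T) ≤ B)
    (hlap : ∫ p, (spaceLap Z p) ^ 2 ∂(cylMeasure d T) ≤ B)
    (j : Fin d → ℕ) (hj : ∑ i, j i ≤ 2) :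
    ∃ G : (Fin d → ℝ) × ℝ → ℝ, Continuous G ∧
      (∀ x t, mder j (fun y => Z (y, t)) x = G (x, t)) ∧
      ∫ p, (G p) ^ 2 ∂(cylMeasure d T) ≤ 2 * B := by
  have hnn : ∀ G : (Fin d → ℝ) × ℝ → ℝ, 0 ≤ ∫ p, (G p) ^ 2 ∂(cylMeasure d T) :=
    fun G => integral_nonneg fun p => sq_nonneg _
  have hB : 0 ≤ B := (hnn Z).trans hmass
  obtain ⟨l, hl, h⟩ : ∃ l : List (Fin d), l.length ≤ 2 ∧
      ∀ v : (Fin d → ℝ) → ℝ, mder j v = l.foldr pder v := exists_mder_eq_foldr j hj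
  match l, hl with
  | [], _ => exact ⟨Z, hZ.continuous, fun x t => by simp [h], by linarith⟩
  | [i], _ =>
    refine ⟨_, (contDiff_dirDeriv hZ (spaceDir i)).continuous, fun x t => ?_, ?_⟩
    · simp [h, pder_slice hZ]
    · have h1 := Finset.single_le_sum (f := fun i : Fin d =>
          ∫ p, (dirDeriv (spaceDir i) Z p) ^ 2 ∂(cylMeasure d T))
          (fun i _ => hnn _) (Finset.mem_univ i)
      have h2 := sum_integral_cyl_dirDeriv_sq_le (T := T) hZ hper
      linarith
  | [i, k], _ =>
    refine ⟨_, (contDiff_dirDeriv (contDiff_dirDeriv hZ (spaceDir k)) (spaceDir i)).continuous,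
      fun x t => ?_, ?_⟩
    · simp [h, pder_slice hZ, pder_slice (contDiff_dirDeriv hZ (spaceDir k))]
    · have h1 := Finset.single_le_sum (f := fun i : Fin d => ∑ k : Fin d,
          ∫ p, (dirDeriv (spaceDir i) (dirDeriv (spaceDir k) Z) p) ^ 2 ∂(cylMeasure d T))
          (fun i _ => Finset.sum_nonneg fun k _ => hnn _) (Finset.mem_univ i)
      have h2 := Finset.single_le_sum (f := fun k : Fin d =>
          ∫ p, (dirDeriv (spaceDir i) (dirDeriv (spaceDir k) Z) p) ^ 2 ∂(cylMeasure d T))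
          (fun k _ => hnn _) (Finset.mem_univ k)
      have h3 := sum_integral_cyl_dirDeriv_dirDeriv_sq (T := T) hZ hper
      linarith
  | _ :: _ :: _ :: _, hl => simp at hl

theorem h21Sq_slice_le {Z : (Fin d → ℝ) × ℝ → ℝ} (hZ : ContDiff ℝ (⊤ : ℕ∞) Z)
    (hper : SpacePeriodic Z) {B : ℝ} (hmass : ∫ p, (Z p) ^ 2 ∂(cylMeasure d T) ≤ B)
    (htime : ∫ p, (dirDeriv timeDir Z p) ^ 2 ∂(cylMeasure d T) ≤ B)
    (hlap : ∫ p, (spaceLap Z p) ^ 2 ∂(cylMeasure d T) ≤ B) :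
    h21Sq T (fun x t => Z (x, t)) ≤ (2 * numMultiIndices d + 2) * B := by
  choose G hGc hG hGB using mder_slice_of_sum_le_two hZ hper hmass hlap
  have hcZ := hZ.continuous
  have hct := (contDiff_dirDeriv hZ timeDir).continuous
  set s := Finset.univ.filter (fun j : Fin d → Fin 3 => (∑ i, (j i : ℕ)) ≤ 2) with hs
  have hspace : ∫ t in Set.Ioc (0 : ℝ) T, ∑ j ∈ s, ∫ x in unitCube d,
      (mder (fun i => (j i : ℕ)) (fun y => Z (y, t)) x) ^ 2 ≤ numMultiIndices d * (2 * B) := by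
    have hmem : ∀ j ∈ s, ∑ i, (j i : ℕ) ≤ 2 := fun j hj => (Finset.mem_filter.1 hj).2
    rw [integral_finsetSum]
    · rw [numMultiIndices, ← hs, ← nsmul_eq_mul]
      refine Finset.sum_le_card_nsmul _ _ _ fun j hj => ?_
      simp only [hG _ (hmem j hj)]
      refine (integral_cyl_eq_time_space ((hGc _ (hmem j hj)).pow 2)).symm.trans_le ?_
      exact hGB _ (hmem j hj)
    · intro j hj
      simp only [hG _ (hmem j hj)]
      exact (integrable_cyl ((hGc _ (hmem j hj)).pow 2)).integral_prod_right
  have htimepart : ∫ x in unitCube d, ∫ t in Set.Ioc (0 : ℝ) T,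
      ((Z (x, t)) ^ 2 + (deriv (fun s => Z (x, s)) t) ^ 2) ≤ B + B := by
    simp only [fun x t => (hasDerivAt_time hZ x t).deriv]
    rw [← integral_cyl_eq_space_time (g := fun p => (Z p) ^ 2 + (dirDeriv timeDir Z p) ^ 2)
      (by fun_prop), integral_add (integrable_cyl (by fun_prop)) (integrable_cyl (by fun_prop))]
    exact add_le_add hmass htime
  unfold h21Sq
  calc _ ≤ numMultiIndices d * (2 * B) + (B + B) := add_le_add hspace htimepart
    _ = _ := by ring

end EnergyEstimates

section ForwardMap

variable {d : ℕ} {T : ℝ}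

theorem LinkFun.exists_le_linear (Φ : LinkFun) :
    ∃ L : ℝ, 0 ≤ L ∧ ∀ y, 1 + Φ.toFun y ≤ L * (1 + |y|) := by
  obtain ⟨C, hC⟩ := Φ.derivs_bdd 1 le_rfl
  have hC0 : 0 ≤ C := (abs_nonneg _).trans (hC 0)
  have hΦ0 : 0 < Φ.toFun 0 := Φ.fmin_pos.trans (Φ.gt_fmin 0)
  refine ⟨1 + Φ.toFun 0 + C, by positivity, fun y => ?_⟩
  have h := Convex.norm_image_sub_le_of_norm_deriv_le (f := Φ.toFun) (s := Set.univ) (C := C)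
    (fun x _ => Φ.smooth.differentiable (by simp) x)
    (fun x _ => by simpa [iteratedDeriv_one] using hC x) convex_univ
    (Set.mem_univ 0) (Set.mem_univ y)
  rw [Real.norm_eq_abs, Real.norm_eq_abs, sub_zero] at h
  have := le_abs_self (Φ.toFun y - Φ.toFun 0)
  nlinarith [abs_nonneg y, mul_nonneg hΦ0.le (abs_nonneg y)]

theorem ZPerSpace.spacePeriodic {u : (Fin d → ℝ) → ℝ → ℝ} (hu : ZPerSpace u) :
    SpacePeriodic fun p => u p.1 p.2 := fun p k => by
  have h := hu p.2 p.1 k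
  simpa [Pi.add_def] using h

theorem HeatSol.dirDeriv_time {θ : ℝ} {f u0 : (Fin d → ℝ) → ℝ} {u : (Fin d → ℝ) → ℝ → ℝ}
    (hu : HeatSol T θ f u0 u) (p : (Fin d → ℝ) × ℝ) (hp : p.2 ∈ Set.Ioc 0 T) :
    dirDeriv timeDir (fun q => u q.1 q.2) p
      = θ / 2 * spaceLap (fun q => u q.1 q.2) p - f p.1 * u p.1 p.2 := by
  have h := hu.2.2.1 p.1 p.2 hp
  rwa [← (hasDerivAt_time hu.1 p.1 p.2).deriv, ← lap_slice hu.1 p.1 p.2]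

theorem ThetaDerivSol.dirDeriv_time {θ : ℝ} {Φ : LinkFun} {F : (Fin d → ℝ) → ℝ}
    {u w : (Fin d → ℝ) → ℝ → ℝ} (hu : SmoothQ u) (hw : ThetaDerivSol T θ Φ F u w)
    (p : (Fin d → ℝ) × ℝ) (hp : p.2 ∈ Set.Ioc 0 T) :
    dirDeriv timeDir (fun q => w q.1 q.2) p
      = θ / 2 * spaceLap (fun q => w q.1 q.2) p - Φ.toFun (F p.1) * w p.1 p.2
        + 1 / 2 * spaceLap (fun q => u q.1 q.2) p := by
  have h := hw.2.2.1 p.1 p.2 hp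
  rwa [← (hasDerivAt_time hw.1 p.1 p.2).deriv, ← lap_slice hw.1 p.1 p.2,
    ← lap_slice hu p.1 p.2]

theorem h1Sq_nonneg (v : (Fin d → ℝ) → ℝ) : 0 ≤ h1Sq v :=
  add_nonneg (integral_nonneg fun _ => sq_nonneg _)
    (Finset.sum_nonneg fun _ _ => integral_nonneg fun _ => sq_nonneg _)

theorem h1Sq_zero : h1Sq (fun _ : Fin d → ℝ => (0 : ℝ)) = 0 := by
  simp [h1Sq, pder]

theorem regularityConst_nonneg {a b m : ℝ} (hb : 0 ≤ b) (hm : 0 ≤ m) :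
    0 ≤ regularityConst a b m := by
  unfold regularityConst
  positivity

theorem h21Sq_taylor_remainder_le (hT : 0 ≤ T) {θmin θmax θ θ₀ A : ℝ} (hθmin : 0 < θmin)
    (hθ : θ ∈ Set.Icc θmin θmax) (hθ₀ : θ₀ ∈ Set.Icc θmin θmax) {Φ : LinkFun}
    {F : (Fin d → ℝ) → ℝ} (hF : Continuous F) (hA : ∀ x, Φ.toFun (F x) ≤ A)
    {u0 : (Fin d → ℝ) → ℝ} {u u₀ w : (Fin d → ℝ) → ℝ → ℝ}
    (hu : HeatSol T θ (fun x => Φ.toFun (F x)) u0 u)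
    (hu₀ : HeatSol T θ₀ (fun x => Φ.toFun (F x)) u0 u₀)
    (hw : ThetaDerivSol T θ₀ Φ F u₀ w) :
    h21Sq T (fun x t => u x t - u₀ x t - (θ - θ₀) * w x t)
      ≤ (2 * numMultiIndices d + 2) *
        ((regularityConst (θmin / 2) (θmax / 2) Φ.fmin * (1 + A)) ^ 3 *
          (((θ - θ₀) / 2) ^ 2) ^ 2 * h1Sq u0) := by
  have hf : Continuous fun x => Φ.toFun (F x) := Φ.smooth.continuous.comp hF
  have hmf : ∀ x, Φ.fmin ≤ Φ.toFun (F x) := fun x => (Φ.gt_fmin _).le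
  have hA0 : 0 < A := (Φ.fmin_pos.trans (Φ.gt_fmin _)).trans_le (hA 0)
  have ha : 0 < θmin / 2 := half_pos hθmin
  have half_mem : ∀ {η}, η ∈ Set.Icc θmin θmax → η / 2 ∈ Set.Icc (θmin / 2) (θmax / 2) :=
    fun h => ⟨by linarith [h.1], by linarith [h.2]⟩
  set U : (Fin d → ℝ) × ℝ → ℝ := fun q => u q.1 q.2 with hUdef
  set U₀ : (Fin d → ℝ) × ℝ → ℝ := fun q => u₀ q.1 q.2 with hU₀def
  set W : (Fin d → ℝ) × ℝ → ℝ := fun q => w q.1 q.2 with hWdef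
  have hU : ContDiff ℝ (⊤ : ℕ∞) U := hu.1
  have hU₀ : ContDiff ℝ (⊤ : ℕ∞) U₀ := hu₀.1
  have hW : ContDiff ℝ (⊤ : ℕ∞) W := hw.1
  have hδW := contDiff_const.mul hW (f := fun _ => θ - θ₀)
  have hV := hU.sub hU₀
  have hVper := hu.2.1.spacePeriodic.sub hu₀.2.1.spacePeriodic
  have hcLU := (contDiff_spaceLap hU).continuous
  have hcLV := (contDiff_spaceLap hV).continuous
  have eU : ∀ p : (Fin d → ℝ) × ℝ, p.2 ∈ Set.Ioc 0 T → dirDeriv timeDir U p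
      = θ / 2 * spaceLap U p - Φ.toFun (F p.1) * U p := hu.dirDeriv_time
  have eU₀ : ∀ p : (Fin d → ℝ) × ℝ, p.2 ∈ Set.Ioc 0 T → dirDeriv timeDir U₀ p
      = θ₀ / 2 * spaceLap U₀ p - Φ.toFun (F p.1) * U₀ p := hu₀.dirDeriv_time
  have eW : ∀ p : (Fin d → ℝ) × ℝ, p.2 ∈ Set.Ioc 0 T → dirDeriv timeDir W p
      = θ₀ / 2 * spaceLap W p - Φ.toFun (F p.1) * W p + 1 / 2 * spaceLap U₀ p :=
    hw.dirDeriv_time hu₀.1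
  obtain ⟨-, -, hlapU⟩ := heat_maximal_regularity hT ha (half_mem hθ) Φ.fmin_pos hf hmf hA hU
    hu.2.1.spacePeriodic (g := fun _ => 0) continuous_const
    (fun p hp => by rw [eU p hp, add_zero]) rfl
  obtain ⟨-, -, hlapV⟩ := heat_maximal_regularity hT ha (half_mem hθ₀) Φ.fmin_pos hf hmf hA hV
    hVper (g := fun p => (θ - θ₀) / 2 * spaceLap U p) (by fun_prop)
    (fun p hp => by
      simp only [dirDeriv_sub hU hU₀, eU p hp, eU₀ p hp, spaceLap_sub hU hU₀]
      ring) rfl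
  obtain ⟨hmass, htime, hlap⟩ := heat_maximal_regularity hT ha (half_mem hθ₀) Φ.fmin_pos hf hmf
    hA (hV.sub hδW) (hVper.sub (hw.2.1.spacePeriodic.const_mul _))
    (g := fun p => (θ - θ₀) / 2 * spaceLap (fun q => U q - U₀ q) p) (by fun_prop)
    (fun p hp => by
      simp only [dirDeriv_sub hV hδW, dirDeriv_sub hU hU₀, dirDeriv_const_mul hW, eU p hp,
        eU₀ p hp, eW p hp, spaceLap_sub hV hδW, spaceLap_const_mul hW, spaceLap_sub hU hU₀]
      ring) rfl
  have hU0 : (fun x => U (x, 0)) = u0 := funext hu.2.2.2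
  have hV0 : (fun x => U (x, 0) - U₀ (x, 0)) = fun _ => 0 :=
    funext fun x => by simp only [hUdef, hU₀def, hu.2.2.2, hu₀.2.2.2, sub_self]
  have hR0 : (fun x => U (x, 0) - U₀ (x, 0) - (θ - θ₀) * W (x, 0)) = fun _ => 0 :=
    funext fun x => by
      simp only [hUdef, hU₀def, hWdef, hu.2.2.2, hu₀.2.2.2, hw.2.2.2, sub_self, mul_zero]
  have hK := regularityConst_nonneg (a := θmin / 2) (b := θmax / 2) (m := Φ.fmin)
    (ha.le.trans ((half_mem hθ).1.trans (half_mem hθ).2)) Φ.fmin_pos.le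
  have hbound := h21Sq_slice_le (hV.sub hδW)
    (hVper.sub (hw.2.1.spacePeriodic.const_mul _)) hmass htime hlap
  refine hbound.trans (mul_le_mul_of_nonneg_left ?_ (by positivity))
  rw [hU0] at hlapU
  rw [hV0, h1Sq_zero] at hlapV
  rw [hR0, h1Sq_zero]
  simp only [mul_pow, integral_const_mul, zero_add] at hlapV ⊢
  have hzero : ∫ _ : (Fin d → ℝ) × ℝ, (0 : ℝ) ^ 2 ∂(cylMeasure d T) = 0 := by simp
  rw [hzero, add_zero] at hlapU
  set K := regularityConst (θmin / 2) (θmax / 2) Φ.fmin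
  calc _ ≤ K * (1 + A) * (((θ - θ₀) / 2) ^ 2 *
        (K * (1 + A) * (((θ - θ₀) / 2) ^ 2 * (K * (1 + A) * h1Sq u0)))) := by
        refine mul_le_mul_of_nonneg_left (mul_le_mul_of_nonneg_left (hlapV.trans ?_) ?_) ?_
        · exact mul_le_mul_of_nonneg_left (mul_le_mul_of_nonneg_left hlapU (by positivity))
            (by positivity)
        · positivity
        · positivity
    _ = _ := by ring

end ForwardMap

/-- second-order Taylor bound in `θ` for the forward map
(Lemma `bounds`, item (v)). -/
theorem forward_map_taylor_in_theta {d : ℕ} (hd : 1 ≤ d) (T θmin θmax : ℝ)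
    (hT : 0 < T) (hθmin : 0 < θmin) (hθ : θmin ≤ θmax) (Φ : LinkFun)
    (u0 : (Fin d → ℝ) → ℝ) (hu0 : ContDiff ℝ (⊤ : ℕ∞) u0) (hu0per : ZPer u0) :
    ∃ D > (0 : ℝ), ∀ θ ∈ Set.Icc θmin θmax, ∀ θ₀ ∈ Set.Icc θmin θmax,
      ∀ F : (Fin d → ℝ) → ℝ, Continuous F → ZPer F → (∃ M, ∀ x, |F x| ≤ M) →
      ∀ u u₀ w : (Fin d → ℝ) → ℝ → ℝ,
        HeatSol T θ (fun x => Φ.toFun (F x)) u0 u →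
        HeatSol T θ₀ (fun x => Φ.toFun (F x)) u0 u₀ →
        ThetaDerivSol T θ₀ Φ F u₀ w →
        h21 T (fun x t => u x t - u₀ x t - (θ - θ₀) * w x t)
          ≤ D * |θ - θ₀| ^ 2 * (1 + l2T F) * (1 + supT F) ^ 2 := by
  obtain ⟨L, hL, hΦ⟩ := Φ.exists_le_linear
  have hK : 0 ≤ regularityConst (θmin / 2) (θmax / 2) Φ.fmin :=
    regularityConst_nonneg (by linarith) Φ.fmin_pos.le
  have hE := h1Sq_nonneg u0
  set K := regularityConst (θmin / 2) (θmax / 2) Φ.fmin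
  set c : ℝ := (2 * numMultiIndices d + 2) * ((K * L) ^ 3 * h1Sq u0) with hc
  have hc0 : 0 ≤ c := by positivity
  refine ⟨√c + 1, by positivity, ?_⟩
  rintro θ hθ' θ₀ hθ₀ F hF - ⟨M, hM⟩ u u₀ w hu hu₀ hw
  have hs : ∀ x, |F x| ≤ supT F := fun x => le_ciSup ⟨M, by rintro _ ⟨y, rfl⟩; exact hM y⟩ x
  have hs0 : 0 ≤ supT F := (abs_nonneg _).trans (hs 0)
  have hA : ∀ x, Φ.toFun (F x) ≤ L * (1 + supT F) - 1 := fun x => by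
    have h1 := hΦ (F x)
    have h2 := mul_le_mul_of_nonneg_left (add_le_add_right (hs x) 1) hL
    linarith
  have h := h21Sq_taylor_remainder_le hT.le hθmin hθ' hθ₀ hF hA hu hu₀ hw
  rw [add_sub_cancel] at h
  have hsq : h21Sq T (fun x t => u x t - u₀ x t - (θ - θ₀) * w x t)
      ≤ c * (|θ - θ₀| ^ 2 * (1 + supT F) ^ 2) ^ 2 := by
    refine h.trans ?_
    rw [sq_abs]
    have h1 : (1 + supT F) ^ 3 ≤ (1 + supT F) ^ 4 :=
      pow_le_pow_right₀ (by linarith) (by norm_num)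
    calc _ = c * ((θ - θ₀) ^ 4 / 16 * (1 + supT F) ^ 3) := by rw [hc]; ring
      _ ≤ c * ((θ - θ₀) ^ 4 * (1 + supT F) ^ 4) := by
        gcongr
        have : 0 ≤ (θ - θ₀) ^ 4 := by positivity
        linarith
      _ = _ := by ring
  have hl2 : 0 ≤ l2T F := Real.sqrt_nonneg _
  calc h21 T (fun x t => u x t - u₀ x t - (θ - θ₀) * w x t)
      ≤ √(c * (|θ - θ₀| ^ 2 * (1 + supT F) ^ 2) ^ 2) := Real.sqrt_le_sqrt hsq
    _ = √c * (|θ - θ₀| ^ 2 * (1 + supT F) ^ 2) := by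
      rw [Real.sqrt_mul hc0, Real.sqrt_sq (by positivity)]
    _ ≤ (√c + 1) * (|θ - θ₀| ^ 2 * (1 + supT F) ^ 2) * (1 + l2T F) := by
      refine (mul_le_mul_of_nonneg_right (lt_add_one _).le (by positivity)).trans ?_
      exact le_mul_of_one_le_right (by positivity) (by linarith)
    _ = _ := by ring
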